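/- Let m, n, ℓ, ñ be integers with m ≥ 6, n ≥ m, 0 ≤ ℓ ≤ m, ñ ≥ 0 and 4mñ < m², and set Δ = 4mn − ℓ². Then Σ_{ℓ̃: 0 ≤ ℓ̃ < m, 4mñ − ℓ̃² < 0} 2·ĉ_m^F(ñ, ℓ̃)·(ℓ̃² − 4mñ)^{23/4}·I_{23/2}(π√(Δ(ℓ̃² − 4mñ))/m) < 0.123·c_m^F(ñ, m)·(m² − 4mñ)^{23/4}·I_{23/2}(π√(Δ(m² − 4mñ))/m), where ĉ_m^F(ñ, ℓ̃) = (ℓ̃ − 2ñ)·d(m + ñ − ℓ̃)·d(ñ). -/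

import Mathlib

open Real

/-- The modified Bessel function of the first kind. -/
noncomputable def besselI (ν x : ℝ) : ℝ :=
  ∑' k : ℕ, (x / 2) ^ (2 * (k : ℝ) + ν) / ((k.factorial : ℝ) * Real.Gamma ((k : ℝ) + ν + 1))

/-- `d n`: the coefficient of `q^(n+1)` in `∏ (1 - q^j)^{-24}`. -/
def dcoef (n : ℤ) : ℤ :=
  if 0 ≤ n + 1 then
    ∑ v ∈ Finset.Nat.antidiagonalTuple 24 (n + 1).toNat,
      ∏ i, (Fintype.card (Nat.Partition (v i)) : ℤ)
  else 0

/-- The polar coefficient `c_m^F(ñ, ℓ̃)`, given by the `SL(2,ℤ)` continued-fraction sum. -/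
noncomputable def polarCoef (m nt ℓt : ℤ) : ℤ :=
  ∑ᶠ (p : ℤ) (q : ℤ) (r : ℤ) (s : ℤ),
    if p * s - q * r = 1 ∧ 0 < r ∧ 0 < s ∧
        0 ≤ (ℓt : ℚ) / (2 * m) - (q : ℚ) / s ∧
        (ℓt : ℚ) / (2 * m) - (q : ℚ) / s < 1 / ((r : ℚ) * s) then
      (-2 * r * s * nt - 2 * p * q * m + (p * s + q * r) * ℓt) *
        dcoef (r ^ 2 * nt + p ^ 2 * m - p * r * ℓt) *
        dcoef (s ^ 2 * nt + q ^ 2 * m - q * s * ℓt)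
    else 0

/-- The total multiplicity of the part `i` over all partitions of `n`. -/
theorem Nat.Partition.sum_count_eq {i : ℕ} (hi : 1 ≤ i) (n : ℕ) :
    ∑ p : n.Partition, p.parts.count i =
      ∑ k ∈ (Finset.Icc 1 n).filter (i ∣ ·), Fintype.card (n - k).Partition := by
  classical
  induction n using Nat.strong_induction_on with
  | _ n ih =>
    by_cases hin : i ≤ n
    · have h1 : ∑ p : n.Partition, p.parts.count i =
          ∑ p : {p : n.Partition // i ∈ p.parts}, p.1.parts.count i := by
        rw [← Finset.sum_subtype (Finset.univ.filter fun p : n.Partition => i ∈ p.parts)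
          (by simp) fun p => p.parts.count i, Finset.sum_filter]
        refine Finset.sum_congr rfl fun p _ => ?_
        split_ifs with h
        · rfl
        · exact Multiset.count_eq_zero_of_notMem h
      rw [h1, ← (Nat.Partition.partitionWithPartEquiv hi hin).symm.sum_comp]
      simp only [Nat.Partition.partitionWithPartEquiv_symm_apply_parts, Multiset.count_cons_self]
      rw [Finset.sum_add_distrib, ih (n - i) (by omega)]
      have h2 : (Finset.Icc 1 n).filter (i ∣ ·) =
          insert i (((Finset.Icc 1 (n - i)).filter (i ∣ ·)).map (addLeftEmbedding i)) := by
        ext k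
        simp only [Finset.mem_filter, Finset.mem_Icc, Finset.mem_insert, Finset.mem_map,
          addLeftEmbedding_apply]
        constructor
        · rintro ⟨⟨h1, h2⟩, c, rfl⟩
          rcases c with _ | _ | c
          · omega
          · left; ring
          · right
            refine ⟨i * (c + 1), ⟨⟨by nlinarith, ?_⟩, dvd_mul_right _ _⟩, by ring⟩
            have : i * (c + 1 + 1) = i * (c + 1) + i := by ring
            omega
        · rintro (rfl | ⟨a, ⟨⟨h1, h2⟩, h3⟩, rfl⟩)
          · exact ⟨⟨hi, hin⟩, dvd_rfl⟩
          · exact ⟨⟨by omega, by omega⟩, dvd_add dvd_rfl h3⟩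
      rw [h2, Finset.sum_insert]
      · rw [Finset.sum_map, add_comm]
        simp [Nat.sub_sub]
      · simp
    · rw [Finset.sum_eq_zero, Finset.sum_eq_zero]
      · intro k hk
        simp only [Finset.mem_filter, Finset.mem_Icc] at hk
        have := Nat.le_of_dvd (by omega) hk.2
        omega
      · intro p _
        exact Multiset.count_eq_zero_of_notMem fun h => hin (Nat.Partition.le_of_mem_parts h)

/-- The recurrence `n p(n) = ∑ σ(k) p(n - k)` for the partition function. -/
theorem Nat.Partition.mul_card_eq_sum (n : ℕ) :
    n * Fintype.card n.Partition =
      ∑ k ∈ Finset.Icc 1 n, (∑ i ∈ k.divisors, i) * Fintype.card (n - k).Partition := by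
  have h1 : ∀ p : n.Partition, ∑ i ∈ Finset.Icc 1 n, i * p.parts.count i = n := by
    intro p
    conv_rhs => rw [← p.parts_sum]
    rw [Finset.sum_multiset_count_of_subset p.parts (Finset.Icc 1 n)]
    · simp [mul_comm]
    · intro a ha
      rw [Multiset.mem_toFinset] at ha
      exact Finset.mem_Icc.2 ⟨p.parts_pos ha, Nat.Partition.le_of_mem_parts ha⟩
  calc n * Fintype.card n.Partition
      = ∑ p : n.Partition, ∑ i ∈ Finset.Icc 1 n, i * p.parts.count i := by
        simp [h1, mul_comm]
    _ = ∑ i ∈ Finset.Icc 1 n, ∑ k ∈ Finset.Icc 1 n,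
          if i ∣ k then i * Fintype.card (n - k).Partition else 0 := by
        rw [Finset.sum_comm]
        refine Finset.sum_congr rfl fun i hi => ?_
        rw [← Finset.mul_sum, Nat.Partition.sum_count_eq (Finset.mem_Icc.1 hi).1, Finset.mul_sum,
          Finset.sum_filter]
    _ = _ := by
        rw [Finset.sum_comm]
        refine Finset.sum_congr rfl fun k hk => ?_
        rw [← Finset.sum_filter, Finset.sum_mul]
        refine Finset.sum_congr ?_ fun _ _ => rfl
        ext i
        simp only [Finset.mem_filter, Finset.mem_Icc, Nat.mem_divisors] at hk ⊢
        constructor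
        · rintro ⟨_, h⟩
          exact ⟨h, by omega⟩
        · rintro ⟨h, _⟩
          exact ⟨⟨Nat.pos_of_dvd_of_pos h (by omega),
            (Nat.le_of_dvd (by omega) h).trans hk.2⟩, h⟩

/-- The generating function of the partition numbers. -/
noncomputable def partitionSeries : PowerSeries ℤ :=
  PowerSeries.mk fun n => (Fintype.card n.Partition : ℤ)

/-- The sum of divisors, as an integer. -/
def divisorSum (k : ℕ) : ℤ := ∑ i ∈ k.divisors, (i : ℤ)

theorem X_mul_derivative_partitionSeries :
    PowerSeries.X * PowerSeries.derivative ℤ partitionSeries =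
      PowerSeries.mk divisorSum * partitionSeries := by
  ext n
  rw [PowerSeries.coeff_mul (φ := PowerSeries.mk divisorSum)]
  rcases n with _ | n
  · simp [divisorSum]
  · rw [PowerSeries.coeff_succ_X_mul, PowerSeries.coeff_derivative]
    have h := congrArg (Nat.cast : ℕ → ℤ) (Nat.Partition.mul_card_eq_sum (n + 1))
    push_cast at h
    rw [Finset.Nat.sum_antidiagonal_eq_sum_range_succ_mk,
      Finset.sum_range_eq_add_Ico _ (by omega)]
    simp only [partitionSeries, PowerSeries.coeff_mk, divisorSum, Nat.divisors_zero,
      Finset.sum_empty, zero_mul, zero_add]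
    rw [Nat.succ_eq_add_one, Finset.Ico_add_one_right_eq_Icc]
    linarith

/-- The coefficients of the 24th power of the partition generating function. -/
noncomputable def colouredCount (n : ℕ) : ℤ := (partitionSeries ^ 24).coeff n

theorem mul_colouredCount (n : ℕ) :
    n * colouredCount n =
      24 * ∑ x ∈ Finset.HasAntidiagonal.antidiagonal n, divisorSum x.1 * colouredCount x.2 := by
  have h : PowerSeries.X * PowerSeries.derivative ℤ (partitionSeries ^ 24) =
      24 * (PowerSeries.mk divisorSum * partitionSeries ^ 24) := by
    rw [PowerSeries.derivative_pow]
    have := X_mul_derivative_partitionSeries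
    push_cast
    linear_combination 24 * partitionSeries ^ 23 * this
  have h' := congrArg (PowerSeries.coeff n) h
  have e : (24 : PowerSeries ℤ) = PowerSeries.C 24 := by simp
  rw [e, PowerSeries.coeff_C_mul,
    PowerSeries.coeff_mul (φ := PowerSeries.mk divisorSum)] at h'
  simp only [PowerSeries.coeff_mk] at h'
  simp only [colouredCount]
  rw [← h']
  rcases n with _ | n
  · simp
  · rw [PowerSeries.coeff_succ_X_mul, PowerSeries.coeff_derivative]
    push_cast; ring

theorem dcoef_eq_colouredCount (n : ℕ) : dcoef ((n : ℤ) - 1) = colouredCount n := by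
  classical
  have e : partitionSeries ^ 24 = ∏ _i : Fin 24, partitionSeries := by simp
  rw [colouredCount, e, PowerSeries.coeff_prod, dcoef, if_pos (by omega)]
  have : ((n : ℤ) - 1 + 1).toNat = n := by omega
  rw [this]
  refine Finset.sum_bij' (fun v _ => Finsupp.equivFunOnFinite.symm v) (fun l _ => l)
    ?_ ?_ ?_ ?_ ?_
  · intro v hv
    rw [Finset.Nat.mem_antidiagonalTuple] at hv
    simpa using hv
  · intro l hl
    rw [Finset.Nat.mem_antidiagonalTuple]
    simpa using hl
  · intro v hv; simp
  · intro l hl; ext; simp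
  · intro v hv; simp [partitionSeries]

theorem colouredCount_zero : colouredCount 0 = 1 := by
  simp [colouredCount, partitionSeries]

theorem succ_mul_colouredCount_succ (n : ℕ) :
    ((n : ℤ) + 1) * colouredCount (n + 1) =
      24 * ∑ k ∈ Finset.range (n + 1), divisorSum (k + 1) * colouredCount (n - k) := by
  have h := mul_colouredCount (n + 1)
  rw [Finset.Nat.sum_antidiagonal_eq_sum_range_succ_mk, Finset.sum_range_succ'] at h
  simpa [divisorSum] using h

theorem divisorSum_pos (k : ℕ) : 1 ≤ divisorSum (k + 1) := by
  have : (1 : ℤ) = ((1 : ℕ) : ℤ) := rfl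
  rw [divisorSum, this]
  exact Finset.single_le_sum (f := fun i : ℕ => (i : ℤ)) (fun i _ => by positivity)
    (Nat.one_mem_divisors.2 k.succ_ne_zero)

theorem divisorSum_le_sq (k : ℕ) : divisorSum k ≤ (k : ℤ) ^ 2 := by
  calc divisorSum k ≤ ∑ _i ∈ k.divisors, (k : ℤ) :=
        Finset.sum_le_sum fun i hi => by exact_mod_cast Nat.divisor_le hi
    _ = k.divisors.card * (k : ℤ) := by simp
    _ ≤ (k : ℤ) ^ 2 := by
        rw [sq]
        exact mul_le_mul_of_nonneg_right (by exact_mod_cast Nat.card_divisors_le_self k)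
          (by positivity)

theorem colouredCount_pos (n : ℕ) : 0 < colouredCount n := by
  induction n using Nat.strong_induction_on with
  | _ n ih =>
    rcases n with _ | n
    · simp [colouredCount_zero]
    · have h := succ_mul_colouredCount_succ n
      have : 0 < ∑ k ∈ Finset.range (n + 1), divisorSum (k + 1) * colouredCount (n - k) :=
        Finset.sum_pos (fun k _ => mul_pos (by linarith [divisorSum_pos k]) (ih _ (by omega)))
          (by simp)
      have h2 : 0 < ((n : ℤ) + 1) * colouredCount (n + 1) := by rw [h]; positivity
      exact pos_of_mul_pos_right h2 (by positivity)

theorem colouredCount_one : colouredCount 1 = 24 := by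
  have h := succ_mul_colouredCount_succ 0
  simp [colouredCount_zero, divisorSum] at h
  exact h

theorem colouredCount_two : colouredCount 2 = 324 := by
  have h := succ_mul_colouredCount_succ 1
  have e : divisorSum 2 = 3 := by decide
  have e' : divisorSum 1 = 1 := by decide
  simp [Finset.sum_range_succ, colouredCount_zero, colouredCount_one, e, e'] at h
  linarith

theorem colouredCount_three : colouredCount 3 = 3200 := by
  have h := succ_mul_colouredCount_succ 2
  have e : divisorSum 2 = 3 := by decide
  have e' : divisorSum 1 = 1 := by decide
  have e'' : divisorSum 3 = 4 := by decide
  simp [Finset.sum_range_succ, colouredCount_zero, colouredCount_one, colouredCount_two,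
    e, e', e''] at h
  linarith

theorem sum_colouredCount_le (n : ℕ) :
    24 * ∑ j ∈ Finset.range (n + 1), colouredCount j ≤
      ((n : ℤ) + 1) * colouredCount (n + 1) := by
  rw [succ_mul_colouredCount_succ, ← Finset.sum_range_reflect]
  refine mul_le_mul_of_nonneg_left (Finset.sum_le_sum fun k _ => ?_) (by norm_num)
  have e : n + 1 - 1 - k = n - k := by omega
  rw [e]
  nlinarith [divisorSum_pos k, colouredCount_pos (n - k)]

theorem sq_le_colouredCount_of_cube_le_sum {n : ℕ}
    (h : 10 * ((n : ℤ) + 1) ^ 3 ≤ ∑ j ∈ Finset.range (n + 1), colouredCount j) :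
    240 * ((n : ℤ) + 1) ^ 2 ≤ colouredCount (n + 1) := by
  have h' := sum_colouredCount_le n
  have : ((n : ℤ) + 1) * (240 * ((n : ℤ) + 1) ^ 2) ≤ ((n : ℤ) + 1) * colouredCount (n + 1) := by
    linarith
  exact le_of_mul_le_mul_left this (by positivity)

theorem cube_le_sum_colouredCount (n : ℕ) (hn : 2 ≤ n) :
    10 * ((n : ℤ) + 1) ^ 3 ≤ ∑ j ∈ Finset.range (n + 1), colouredCount j := by
  induction n, hn using Nat.le_induction with
  | base =>
    simp [Finset.sum_range_succ, colouredCount_zero, colouredCount_one, colouredCount_two]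
  | succ n hn ih =>
    have h2 := sq_le_colouredCount_of_cube_le_sum ih
    rw [Finset.sum_range_succ]
    push_cast
    nlinarith

theorem sq_le_colouredCount (n : ℕ) (hn : 2 ≤ n) :
    240 * ((n : ℤ) + 1) ^ 2 ≤ colouredCount (n + 1) :=
  sq_le_colouredCount_of_cube_le_sum (cube_le_sum_colouredCount n hn)

theorem colouredCount_succ_le (n : ℕ) (hn : 2 ≤ n) :
    colouredCount (n + 1) ≤ 10 * colouredCount n := by
  induction n using Nat.strong_induction_on with
  | _ N ih =>
    rcases hn.eq_or_lt with rfl | hN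
    · rw [colouredCount_two, colouredCount_three]; norm_num
    · obtain ⟨n, rfl⟩ : ∃ n, N = n + 2 := ⟨N - 2, by omega⟩
      have h1 := succ_mul_colouredCount_succ (n + 2)
      have h0 := succ_mul_colouredCount_succ (n + 1)
      rw [Finset.sum_range_succ, Finset.sum_range_succ] at h0
      rw [Finset.sum_range_succ, Finset.sum_range_succ, Finset.sum_range_succ] at h1
      have e1 : n + 1 - n = 1 := by omega
      have e2 : n + 2 - n = 2 := by omega
      have e3 : n + 2 - (n + 1) = 1 := by omega
      simp only [e1, e2, e3, Nat.sub_self, colouredCount_zero, colouredCount_one,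
        colouredCount_two] at h0 h1
      have hs : ∑ k ∈ Finset.range n, divisorSum (k + 1) * colouredCount (n + 2 - k) ≤
          10 * ∑ k ∈ Finset.range n, divisorSum (k + 1) * colouredCount (n + 1 - k) := by
        rw [Finset.mul_sum]
        refine Finset.sum_le_sum fun k hk => ?_
        rw [Finset.mem_range] at hk
        have := ih (n + 1 - k) (by omega) (by omega)
        have e : n + 2 - k = n + 1 - k + 1 := by omega
        rw [e]
        nlinarith [divisorSum_pos k]
      have b1 := divisorSum_le_sq (n + 1)
      have b2 := divisorSum_le_sq (n + 2)
      have b3 := divisorSum_le_sq (n + 3)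
      have hq := sq_le_colouredCount (n + 1) (by omega)
      push_cast at b1 b2 b3 h0 h1 hq
      have e4 : n + 1 + 1 = n + 2 := rfl
      have e5 : n + 2 + 1 = n + 3 := rfl
      simp only [e4, e5] at *
      have key : ((n : ℤ) + 3) * colouredCount (n + 3) ≤
          ((n : ℤ) + 3) * (10 * colouredCount (n + 2)) := by
        nlinarith
      exact le_of_mul_le_mul_left key (by positivity)

theorem dcoef_natCast (k : ℕ) : dcoef k = colouredCount (k + 1) := by
  rw [← dcoef_eq_colouredCount]; congr 1; push_cast; ring

theorem dcoef_nonneg (n : ℤ) : 0 ≤ dcoef n := by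
  rw [dcoef]
  split_ifs
  · exact Finset.sum_nonneg fun _ _ => Finset.prod_nonneg fun _ _ => by positivity
  · rfl

theorem dcoef_eq_zero {n : ℤ} (h : n < -1) : dcoef n = 0 := by
  rw [dcoef, if_neg (by omega)]

theorem dcoef_natCast_pos (k : ℕ) : 0 < dcoef k := by
  rw [dcoef_natCast]; exact colouredCount_pos _

theorem dcoef_add_le (k j : ℕ) :
    20 * dcoef ((k + (j + 1) : ℕ) : ℤ) ≤ 27 * 10 ^ (j + 1) * dcoef k := by
  simp only [dcoef_natCast]
  induction j with
  | zero =>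
    rcases k with _ | k
    · rw [colouredCount_two, colouredCount_one]; norm_num
    · have := colouredCount_succ_le (k + 1 + 1) (by omega)
      have h2 := colouredCount_pos (k + 1 + 1)
      simp only [zero_add, pow_one]
      linarith
  | succ j ih =>
    have := colouredCount_succ_le (k + (j + 1) + 1) (by omega)
    have e : k + (j + 1 + 1) + 1 = k + (j + 1) + 1 + 1 := by ring
    rw [e, pow_succ]
    linarith

/-- The coefficient of `u ^ (2 * k + 23)` in `u ^ (23 / 2) * besselI (23 / 2) u`. -/
noncomputable def besselCoeff (k : ℕ) : ℝ :=
  ((2 : ℝ) ^ (2 * (k : ℝ) + 23 / 2))⁻¹ /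
    ((k.factorial : ℝ) * Real.Gamma ((k : ℝ) + 23 / 2 + 1))

theorem besselCoeff_pos (k : ℕ) : 0 < besselCoeff k := by
  have : 0 < Real.Gamma ((k : ℝ) + 23 / 2 + 1) := Real.Gamma_pos_of_pos (by positivity)
  rw [besselCoeff]; positivity

theorem besselCoeff_succ (k : ℕ) :
    besselCoeff k = besselCoeff (k + 1) * ((2 * k + 2) * (2 * k + 25)) := by
  have hG : 0 < Real.Gamma ((k : ℝ) + 23 / 2 + 1) := Real.Gamma_pos_of_pos (by positivity)
  have h1 : Real.Gamma (((k + 1 : ℕ) : ℝ) + 23 / 2 + 1) =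
      ((k : ℝ) + 23 / 2 + 1) * Real.Gamma ((k : ℝ) + 23 / 2 + 1) := by
    rw [← Real.Gamma_add_one (by positivity)]; congr 1; push_cast; ring
  have h2 : (2 : ℝ) ^ (2 * ((k + 1 : ℕ) : ℝ) + 23 / 2) = 4 * 2 ^ (2 * (k : ℝ) + 23 / 2) := by
    have : 2 * ((k + 1 : ℕ) : ℝ) + 23 / 2 = (2 * (k : ℝ) + 23 / 2) + (2 : ℕ) := by
      push_cast; ring
    rw [this, Real.rpow_add_natCast (by norm_num)]; ring
  have hp : (0 : ℝ) < 2 ^ (2 * (k : ℝ) + 23 / 2) := by positivity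
  rw [besselCoeff, besselCoeff, h1, h2, Nat.factorial_succ]
  push_cast
  field_simp
  ring

theorem besselCoeff_mul_le (k : ℕ) :
    besselCoeff k * ((2 * k + 23) * (2 * k + 22)) ≤ besselCoeff 0 * 506 / k.factorial := by
  induction k with
  | zero => simp; linarith
  | succ k ih =>
    have hs := besselCoeff_succ k
    have hp := besselCoeff_pos (k + 1)
    rw [Nat.factorial_succ]
    push_cast
    rw [mul_comm ((k : ℝ) + 1), ← div_div, le_div_iff₀ (by positivity)]
    refine le_trans ?_ ih
    rw [hs, mul_assoc, mul_assoc (besselCoeff (k + 1)) (_ * _) (_ * _)]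
    refine mul_le_mul_of_nonneg_left ?_ hp.le
    have hk : (0 : ℝ) ≤ k := by positivity
    have : (2 * (k : ℝ) + 24) * (k + 1) ≤ (2 * k + 2) * ((2 * k + 23) * (2 * k + 22)) := by
      nlinarith [mul_nonneg hk hk, mul_nonneg (mul_nonneg hk hk) hk]
    nlinarith [mul_nonneg hk hk]

theorem besselCoeff_mul_pow_le {c : ℝ} {k : ℕ} (hc0 : 0 ≤ c)
    (hc : c ≤ (2 * k + 23) * (2 * k + 22)) (a : ℕ) {u r : ℝ} (h : |u| ≤ r) :
    ‖besselCoeff k * c * u ^ (2 * k + a)‖ ≤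
      besselCoeff 0 * 506 * r ^ a * ((r ^ 2) ^ k / k.factorial) := by
  have hr : 0 ≤ r := (abs_nonneg u).trans h
  rw [norm_mul, norm_pow, Real.norm_eq_abs, Real.norm_eq_abs,
    abs_of_nonneg (mul_nonneg (besselCoeff_pos k).le hc0)]
  calc besselCoeff k * c * |u| ^ (2 * k + a)
      ≤ besselCoeff 0 * 506 / k.factorial * r ^ (2 * k + a) := by
        gcongr
        · have := besselCoeff_pos 0; positivity
        · exact (mul_le_mul_of_nonneg_left hc (besselCoeff_pos k).le).trans (besselCoeff_mul_le k)
    _ = _ := by rw [pow_add, pow_mul]; ring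

theorem summable_besselBound (a : ℕ) (r : ℝ) :
    Summable fun k : ℕ => besselCoeff 0 * 506 * r ^ a * ((r ^ 2) ^ k / k.factorial) :=
  (Real.summable_pow_div_factorial _).mul_left _

theorem summable_besselCoeff_mul {c : ℕ → ℝ} (hc0 : ∀ k, 0 ≤ c k)
    (hc : ∀ k : ℕ, c k ≤ (2 * k + 23) * (2 * k + 22)) (a : ℕ) (u : ℝ) :
    Summable fun k : ℕ => besselCoeff k * c k * u ^ (2 * k + a) :=
  .of_norm_bounded (summable_besselBound a |u|) fun k =>
    besselCoeff_mul_pow_le (hc0 k) (hc k) a le_rfl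

theorem hasDerivAt_besselCoeff_series {c : ℕ → ℝ} (hc0 : ∀ k, 0 ≤ c k) (a : ℕ)
    (hc : ∀ k : ℕ, c k * (2 * k + (a + 1 : ℕ)) ≤ (2 * k + 23) * (2 * k + 22)) (u : ℝ) :
    HasDerivAt (fun u => ∑' k : ℕ, besselCoeff k * c k * u ^ (2 * k + (a + 1)))
      (∑' k : ℕ, besselCoeff k * (c k * (2 * k + (a + 1 : ℕ))) * u ^ (2 * k + a)) u := by
  have hle : ∀ k : ℕ, c k ≤ (2 * k + 23) * (2 * k + 22) := fun k =>
    le_trans (le_mul_of_one_le_right (hc0 k) (by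
      push_cast; have : (0 : ℝ) ≤ k := by positivity
      have : (0 : ℝ) ≤ a := by positivity
      linarith)) (hc k)
  refine hasDerivAt_tsum_of_isPreconnected
    (g := fun k u => besselCoeff k * c k * u ^ (2 * k + (a + 1)))
    (g' := fun k u => besselCoeff k * (c k * (2 * k + (a + 1 : ℕ))) * u ^ (2 * k + a))
    (summable_besselBound a (|u| + 1))
    Metric.isOpen_ball (convex_ball (0 : ℝ) (|u| + 1)).isPreconnected
    (y₀ := 0) ?_ ?_ ?_ ?_ ?_
  · intro k y _
    have := (hasDerivAt_pow (2 * k + (a + 1)) y).const_mul (besselCoeff k * c k)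
    refine this.congr_deriv ?_
    have e : 2 * k + (a + 1) - 1 = 2 * k + a := by omega
    rw [e]; push_cast; ring
  · intro k y hy
    refine besselCoeff_mul_pow_le (mul_nonneg (hc0 k) (by positivity)) (hc k) a ?_
    simpa using (mem_ball_zero_iff.1 hy).le
  · simp; positivity
  · exact summable_besselCoeff_mul hc0 hle (a + 1) 0
  · simp

/-- The entire function `u ^ (23 / 2) * besselI (23 / 2) u`. -/
noncomputable def scaledBessel (u : ℝ) : ℝ := ∑' k : ℕ, besselCoeff k * 1 * u ^ (2 * k + 23)

/-- The derivative of `scaledBessel`. -/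
noncomputable def scaledBesselDeriv (u : ℝ) : ℝ :=
  ∑' k : ℕ, besselCoeff k * (1 * (2 * k + (22 + 1 : ℕ))) * u ^ (2 * k + 22)

/-- The second derivative of `scaledBessel`. -/
noncomputable def scaledBesselDeriv₂ (u : ℝ) : ℝ :=
  ∑' k : ℕ, besselCoeff k * (1 * (2 * k + (22 + 1 : ℕ)) * (2 * k + (21 + 1 : ℕ))) * u ^ (2 * k + 21)

theorem hasDerivAt_scaledBessel (u : ℝ) :
    HasDerivAt scaledBessel (scaledBesselDeriv u) u := by
  refine hasDerivAt_besselCoeff_series (c := fun _ => 1) (fun _ => zero_le_one) 22 (fun k => ?_) u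
  have : (0 : ℝ) ≤ k := by positivity
  push_cast; nlinarith

theorem hasDerivAt_scaledBesselDeriv (u : ℝ) :
    HasDerivAt scaledBesselDeriv (scaledBesselDeriv₂ u) u := by
  refine hasDerivAt_besselCoeff_series (c := fun k => 1 * (2 * k + (22 + 1 : ℕ)))
    (fun _ => by positivity) 21 (fun k => ?_) u
  push_cast; linarith

theorem scaledBessel_le_deriv₂ {u : ℝ} (hu : 0 ≤ u) : scaledBessel u ≤ scaledBesselDeriv₂ u := by
  have h1 : Summable fun k : ℕ => besselCoeff k * 1 * u ^ (2 * k + 23) :=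
    summable_besselCoeff_mul (c := fun _ => 1) (fun _ => zero_le_one) (fun k => by
      have : (0 : ℝ) ≤ k := by positivity
      nlinarith) 23 u
  have h2 : Summable fun k : ℕ => besselCoeff k *
      (1 * (2 * k + (22 + 1 : ℕ)) * (2 * k + (21 + 1 : ℕ))) * u ^ (2 * k + 21) :=
    summable_besselCoeff_mul (c := fun k => 1 * (2 * k + (22 + 1 : ℕ)) * (2 * k + (21 + 1 : ℕ)))
      (fun _ => by positivity) (fun k => by push_cast; linarith) 21 u
  rw [scaledBesselDeriv₂, h2.tsum_eq_zero_add, scaledBessel]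
  have h0 := besselCoeff_pos 0
  refine le_add_of_nonneg_of_le (by positivity)
    (h1.tsum_le_tsum (fun k => ?_) ((summable_nat_add_iff 1).2 h2))
  have e : 2 * (k + 1) + 21 = 2 * k + 23 := by ring
  rw [e, besselCoeff_succ k]
  have hp := besselCoeff_pos (k + 1)
  refine mul_le_mul_of_nonneg_right ?_ (by positivity)
  rw [mul_one]
  refine mul_le_mul_of_nonneg_left ?_ hp.le
  have : (0 : ℝ) ≤ k := by positivity
  push_cast; nlinarith

theorem scaledBessel_le_deriv {u : ℝ} (hu : 0 ≤ u) : scaledBessel u ≤ scaledBesselDeriv u := by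
  have hd : ∀ x, HasDerivAt (fun x => Real.exp x * (scaledBesselDeriv x - scaledBessel x))
      (Real.exp x * (scaledBesselDeriv₂ x - scaledBessel x)) x := fun x => by
    refine ((Real.hasDerivAt_exp x).mul
      ((hasDerivAt_scaledBesselDeriv x).sub (hasDerivAt_scaledBessel x))).congr_deriv ?_
    simp only [Pi.sub_apply]
    ring
  have hm : MonotoneOn (fun x => Real.exp x * (scaledBesselDeriv x - scaledBessel x))
      (Set.Ici 0) := by
    refine monotoneOn_of_deriv_nonneg (convex_Ici 0)
      (fun x _ => (hd x).continuousAt.continuousWithinAt)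
      (fun x _ => (hd x).differentiableAt.differentiableWithinAt) fun x hx => ?_
    rw [(hd x).deriv]
    rw [interior_Ici] at hx
    exact mul_nonneg (Real.exp_pos x).le (sub_nonneg.2 (scaledBessel_le_deriv₂ (le_of_lt hx)))
  have h := hm (Set.self_mem_Ici) (Set.mem_Ici.2 hu) hu
  simp only [scaledBessel, scaledBesselDeriv] at h
  simp only [ne_eq, Nat.add_eq_zero_iff, OfNat.ofNat_ne_zero, and_false, not_false_eq_true,
    zero_pow, mul_zero, tsum_zero, sub_self] at h
  exact sub_nonneg.1 (nonneg_of_mul_nonneg_right h (Real.exp_pos u))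

theorem scaledBessel_mul_exp_le {u v : ℝ} (hu : 0 ≤ u) (huv : u ≤ v) :
    scaledBessel u ≤ Real.exp (-(v - u)) * scaledBessel v := by
  have hd : ∀ x, HasDerivAt (fun x => Real.exp (-x) * scaledBessel x)
      (Real.exp (-x) * (scaledBesselDeriv x - scaledBessel x)) x := fun x => by
    refine ((hasDerivAt_neg x).exp.mul (hasDerivAt_scaledBessel x)).congr_deriv ?_
    ring
  have hm : MonotoneOn (fun x => Real.exp (-x) * scaledBessel x) (Set.Ici 0) := by
    refine monotoneOn_of_deriv_nonneg (convex_Ici 0)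
      (fun x _ => (hd x).continuousAt.continuousWithinAt)
      (fun x _ => (hd x).differentiableAt.differentiableWithinAt) fun x hx => ?_
    rw [(hd x).deriv]
    rw [interior_Ici] at hx
    exact mul_nonneg (Real.exp_pos _).le (sub_nonneg.2 (scaledBessel_le_deriv (le_of_lt hx)))
  have h := hm (Set.mem_Ici.2 hu) (Set.mem_Ici.2 (hu.trans huv)) huv
  have h' := mul_le_mul_of_nonneg_left h (Real.exp_pos u).le
  simp only [← mul_assoc, ← Real.exp_add, add_neg_cancel, Real.exp_zero, one_mul] at h'
  rwa [show -(v - u) = u + -v by ring]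

theorem scaledBessel_pos {u : ℝ} (hu : 0 < u) : 0 < scaledBessel u := by
  refine (summable_besselCoeff_mul (c := fun _ => 1) (fun _ => zero_le_one) (fun k => by
      have : (0 : ℝ) ≤ k := by positivity
      nlinarith) 23 u).tsum_pos (fun k => ?_) 0 ?_
  · have := besselCoeff_pos k; positivity
  · have := besselCoeff_pos 0; positivity

theorem rpow_mul_besselI {u : ℝ} (hu : 0 < u) :
    u ^ ((23 : ℝ) / 2) * besselI (23 / 2) u = scaledBessel u := by
  rw [besselI, scaledBessel, ← tsum_mul_left]
  refine tsum_congr fun k => ?_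
  have e : u ^ (2 * k + 23) = u ^ ((23 : ℝ) / 2) * u ^ (2 * (k : ℝ) + 23 / 2) := by
    rw [← Real.rpow_add hu, ← Real.rpow_natCast]; congr 1; push_cast; ring
  rw [Real.div_rpow hu.le (by norm_num), e, besselCoeff]
  ring

theorem rpow_mul_besselI_mul_sqrt {t w : ℝ} (ht : 0 < t) (hw : 0 < w) :
    w ^ ((23 : ℝ) / 4) * besselI (23 / 2) (t * √w) =
      (t ^ ((23 : ℝ) / 2))⁻¹ * scaledBessel (t * √w) := by
  have hs : 0 < √w := Real.sqrt_pos.2 hw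
  rw [← rpow_mul_besselI (mul_pos ht hs), Real.mul_rpow ht.le hs.le, Real.sqrt_eq_rpow,
    ← Real.rpow_mul hw.le]
  have : 0 < t ^ ((23 : ℝ) / 2) := by positivity
  field_simp
  norm_num
  ring

theorem le_finsum_of_support_Icc {f : ℤ → ℤ} {B : ℤ} (h0 : ∀ x, 0 ≤ f x)
    (hB : ∀ x, f x ≠ 0 → 0 ≤ x ∧ x ≤ B) (a : ℤ) : f a ≤ ∑ᶠ x, f x :=
  single_le_finsum a ((Set.finite_Icc 0 B).subset fun x hx => hB x hx) h0

theorem le_finsum₄_of_support_Icc {F : ℤ → ℤ → ℤ → ℤ → ℤ} {B : ℤ}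
    (h0 : ∀ p q r s, 0 ≤ F p q r s)
    (hB : ∀ p q r s, F p q r s ≠ 0 →
      (0 ≤ p ∧ p ≤ B) ∧ (0 ≤ q ∧ q ≤ B) ∧ (0 ≤ r ∧ r ≤ B) ∧ (0 ≤ s ∧ s ≤ B)) (p q r s : ℤ) :
    F p q r s ≤ ∑ᶠ (p : ℤ) (q : ℤ) (r : ℤ) (s : ℤ), F p q r s := by
  have key : ∀ {f : ℤ → ℤ}, ∑ᶠ x, f x ≠ 0 → ∃ x, f x ≠ 0 := fun h => by
    by_contra! hc
    exact h (by simp [hc])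
  refine (le_finsum_of_support_Icc (B := B) (h0 p q r) (fun x hx => (hB _ _ _ _ hx).2.2.2)
    s).trans ?_
  refine (le_finsum_of_support_Icc (B := B) (f := fun r => ∑ᶠ s, F p q r s)
    (fun r => finsum_nonneg (h0 p q r)) (fun x hx => ?_) r).trans ?_
  · obtain ⟨s, hs⟩ := key hx
    exact (hB _ _ _ _ hs).2.2.1
  refine (le_finsum_of_support_Icc (B := B) (f := fun q => ∑ᶠ (r) (s), F p q r s)
    (fun q => finsum_nonneg fun r => finsum_nonneg (h0 p q r)) (fun x hx => ?_) q).trans ?_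
  · obtain ⟨r, hr⟩ := key hx
    obtain ⟨s, hs⟩ := key hr
    exact (hB _ _ _ _ hs).2.1
  refine le_finsum_of_support_Icc (B := B) (f := fun p => ∑ᶠ (q) (r) (s), F p q r s)
    (fun p => finsum_nonneg fun q => finsum_nonneg fun r => finsum_nonneg (h0 p q r))
    (fun x hx => ?_) p
  obtain ⟨q, hq⟩ := key hx
  obtain ⟨r, hr⟩ := key hq
  obtain ⟨s, hs⟩ := key hr
  exact (hB _ _ _ _ hs).1

theorem polarCoef_lower_bound {m nt : ℤ} (hm : 0 < m) (hnt2 : 4 * nt < m) :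
    (m - 2 * nt) * dcoef nt * dcoef nt ≤ polarCoef m nt m := by
  have hhalf : (m : ℚ) / (2 * m) = 1 / 2 := by
    have : (m : ℚ) ≠ 0 := by exact_mod_cast hm.ne'
    field_simp
  have hcond : ∀ {p q r s : ℤ}, (p * s - q * r = 1 ∧ 0 < r ∧ 0 < s ∧
        0 ≤ (m : ℚ) / (2 * m) - (q : ℚ) / s ∧
        (m : ℚ) / (2 * m) - (q : ℚ) / s < 1 / ((r : ℚ) * s)) →
      p * s - q * r = 1 ∧ 0 < r ∧ 0 < s ∧ 0 ≤ s - 2 * q ∧ 0 < 2 * p - r := by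
    rintro p q r s ⟨h1, hr, hs, h2, h3⟩
    have hr' : (0 : ℚ) < r := by exact_mod_cast hr
    have hs' : (0 : ℚ) < s := by exact_mod_cast hs
    rw [hhalf] at h2 h3
    have e : (1 : ℚ) / 2 - q / s = ((s - 2 * q : ℤ) : ℚ) / (2 * s) := by
      push_cast; field_simp
    rw [e] at h2 h3
    have hQ : 0 ≤ s - 2 * q := by
      rw [le_div_iff₀ (by positivity), zero_mul] at h2
      exact_mod_cast h2
    have hQ' : r * (s - 2 * q) < 2 := by
      rw [div_lt_div_iff₀ (by positivity) (by positivity)] at h3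
      have : (r : ℚ) * ((s - 2 * q : ℤ) : ℚ) < 2 := by
        refine lt_of_mul_lt_mul_right ?_ hs'.le
        linarith
      exact_mod_cast this
    refine ⟨h1, hr, hs, hQ, ?_⟩
    have : 0 < s * (2 * p - r) := by linarith
    exact pos_of_mul_pos_right this hs.le
  refine le_trans (le_of_eq ?_) (le_finsum₄_of_support_Icc (B := m + 4)
    (F := fun p q r s => if p * s - q * r = 1 ∧ 0 < r ∧ 0 < s ∧
        0 ≤ (m : ℚ) / (2 * m) - (q : ℚ) / s ∧
        (m : ℚ) / (2 * m) - (q : ℚ) / s < 1 / ((r : ℚ) * s) then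
      (-2 * r * s * nt - 2 * p * q * m + (p * s + q * r) * m) *
        dcoef (r ^ 2 * nt + p ^ 2 * m - p * r * m) *
        dcoef (s ^ 2 * nt + q ^ 2 * m - q * s * m)
    else 0) ?_ ?_ 1 0 1 1)
  · rw [if_pos]
    · congr 2
      · ring
      · ring_nf
      · ring_nf
    · rw [hhalf]; norm_num
  · intro p q r s
    split_ifs with h
    · obtain ⟨h1, hr, hs, hQ, hP⟩ := hcond h
      refine mul_nonneg (mul_nonneg ?_ (dcoef_nonneg _)) (dcoef_nonneg _)
      have e : 2 * (-2 * r * s * nt - 2 * p * q * m + (p * s + q * r) * m) =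
          r * s * (m - 4 * nt) + m * ((2 * p - r) * (s - 2 * q)) := by ring
      have h2 : 0 ≤ r * s * (m - 4 * nt) := by
        have : 0 ≤ m - 4 * nt := by linarith
        positivity
      have h3 : 0 ≤ m * ((2 * p - r) * (s - 2 * q)) := by positivity
      linarith
    · rfl
  · intro p q r s hne
    split_ifs at hne with h
    swap
    · exact absurd rfl hne
    obtain ⟨h1, hr, hs, hQ, hP⟩ := hcond h
    have hd : -1 ≤ r ^ 2 * nt + p ^ 2 * m - p * r * m := by
      by_contra hc
      exact hne (by rw [dcoef_eq_zero (not_le.1 hc)]; ring)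
    have hsum : s * (2 * p - r) + r * (s - 2 * q) = 2 := by linarith
    have hr2 : 0 ≤ r * (s - 2 * q) := by positivity
    have hsP : s * (2 * p - r) ≤ 2 := by linarith
    have hP2 : 2 * p - r ≤ 2 := by nlinarith
    have hs2 : s ≤ 2 := by nlinarith
    have hrr : r ^ 2 * (m - 4 * nt) ≤ m * (2 * p - r) ^ 2 + 4 := by nlinarith
    have hq : 0 ≤ q := by
      by_contra hc
      have : 2 ≤ -2 * q := by omega
      nlinarith
    have hP1 : 2 * p - r = 1 := by
      by_contra hc
      have hP3 : 2 * p - r = 2 := by omega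
      have hs1 : s = 1 := by rw [hP3] at hsP; omega
      have : r * (s - 2 * q) = 0 := by rw [hP3, hs1] at hsum; rw [hs1]; omega
      rcases mul_eq_zero.1 this with h | h <;> omega
    rw [hP1] at hrr
    have : r ^ 2 ≤ m + 4 := by nlinarith [sq_nonneg r]
    have hrB : r ≤ m + 4 := by nlinarith
    refine ⟨⟨by omega, by omega⟩, ⟨hq, by omega⟩, ⟨by omega, hrB⟩, ⟨by omega, by omega⟩⟩

theorem exp_neg_pi_mul_sqrt_three_le : Real.exp (-(π * √3)) ≤ 0.00435 := by
  have h3 : (1.732 : ℝ) ≤ √3 := Real.le_sqrt_of_sq_le (by norm_num)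
  have hpi : (3.141 : ℝ) ≤ π := by linarith [Real.pi_gt_d4]
  have h : (5.44 : ℝ) ≤ π * √3 := by nlinarith
  have h1 : (2.7182818 : ℝ) ^ 5 ≤ Real.exp 5 := by
    have := Real.exp_one_gt_d9
    rw [show (5 : ℝ) = (5 : ℕ) * 1 by norm_num, Real.exp_nat_mul]
    exact pow_le_pow_left₀ (by norm_num) (by linarith) 5
  have h2 : (1.5525 : ℝ) ≤ Real.exp 0.44 := by
    refine le_trans ?_ (Real.sum_le_exp_of_nonneg (by norm_num) 5)
    norm_num [Finset.sum_range_succ, Nat.factorial]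
  have h4 : (1 / 0.00435 : ℝ) ≤ Real.exp (π * √3) := by
    refine le_trans ?_ (Real.exp_le_exp.2 h)
    rw [show (5.44 : ℝ) = 5 + 0.44 by norm_num, Real.exp_add]
    refine le_trans ?_ (mul_le_mul h1 h2 (by norm_num) (Real.exp_pos _).le)
    norm_num
  rw [Real.exp_neg]
  exact inv_le_of_inv_le₀ (by norm_num) (by simpa using h4)

theorem sub_le_sqrt_sub_sqrt {a b c : ℝ} (hb : 0 ≤ b) (hab : b ≤ a) (hc : 0 ≤ c)
    (hcb : c ≤ b ^ 2) : a - b ≤ √(a ^ 2 - c) - √(b ^ 2 - c) := by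
  have h : √(b ^ 2 - c) ≤ b := Real.sqrt_le_iff.2 ⟨hb, by linarith⟩
  have h0 := Real.sqrt_nonneg (b ^ 2 - c)
  have hs := Real.sq_sqrt (sub_nonneg.2 hcb)
  have : a - b + √(b ^ 2 - c) ≤ √(a ^ 2 - c) := Real.le_sqrt_of_sq_le (by nlinarith)
  linarith

theorem sum_pow_toNat_sub_le {x : ℝ} (hx0 : 0 ≤ x) (hx1 : x < 1) (m : ℤ) :
    ∑ l ∈ Finset.Ico (0 : ℤ) m, x ^ (m - l).toNat ≤ x / (1 - x) := by
  have h : ∑ l ∈ Finset.Ico (0 : ℤ) m, x ^ (m - l).toNat =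
      ∑ j ∈ Finset.range m.toNat, x ^ (j + 1) := by
    refine Finset.sum_bij' (fun l _ => (m - l).toNat - 1) (fun j _ => m - 1 - j) ?_ ?_ ?_ ?_ ?_
    · intro l hl; simp only [Finset.mem_Ico, Finset.mem_range] at *; omega
    · intro l hl; simp only [Finset.mem_Ico, Finset.mem_range] at *; omega
    · intro l hl; simp only [Finset.mem_Ico] at *; omega
    · intro l hl; simp only [Finset.mem_range] at *; omega
    · intro l hl
      simp only [Finset.mem_Ico] at *
      congr 1; omega
  rw [h]
  simp only [pow_succ]
  rw [← Finset.sum_mul, mul_comm, div_eq_mul_inv]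
  refine mul_le_mul_of_nonneg_left ?_ hx0
  rw [← tsum_geometric_of_lt_one hx0 hx1]
  exact (summable_geometric_of_lt_one hx0 hx1).sum_le_tsum _ fun _ _ => by positivity

theorem scaledBessel_decay {t a b c : ℝ} (ht : π * √3 ≤ t) (hb : 0 ≤ b) (hab : b ≤ a)
    (hc : 0 ≤ c) (hcb : c ≤ b ^ 2) :
    scaledBessel (t * √(b ^ 2 - c)) ≤
      Real.exp (-(π * √3 * (a - b))) * scaledBessel (t * √(a ^ 2 - c)) := by
  have hp : 0 ≤ π * √3 := by positivity
  have ht0 : 0 ≤ t := hp.trans ht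
  have hd := sub_le_sqrt_sub_sqrt hb hab hc hcb
  have hle : √(b ^ 2 - c) ≤ √(a ^ 2 - c) := by linarith
  refine (scaledBessel_mul_exp_le (by positivity) (mul_le_mul_of_nonneg_left hle ht0)).trans ?_
  refine mul_le_mul_of_nonneg_right (Real.exp_le_exp.2 (neg_le_neg ?_)) ?_
  · rw [← mul_sub]
    exact mul_le_mul ht hd (by linarith) ht0
  · refine tsum_nonneg fun k => ?_
    have := besselCoeff_pos k
    positivity

theorem stmt15 (m n ℓ nt : ℤ) (hm : 6 ≤ m) (hn : m ≤ n) (hℓ0 : 0 ≤ ℓ) (hℓm : ℓ ≤ m)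
    (hnt : 0 ≤ nt) (hnt2 : 4 * m * nt < m ^ 2) :
    ∑ ℓt ∈ (Finset.Ico (0 : ℤ) m).filter fun ℓt => 4 * m * nt - ℓt ^ 2 < 0,
        2 * (((ℓt - 2 * nt) * dcoef (m + nt - ℓt) * dcoef nt : ℤ) : ℝ) *
          ((ℓt ^ 2 - 4 * m * nt : ℤ) : ℝ) ^ ((23 : ℝ) / 4) *
          besselI (23 / 2)
            (Real.pi * Real.sqrt (((4 * m * n - ℓ ^ 2 : ℤ) : ℝ) *
              ((ℓt ^ 2 - 4 * m * nt : ℤ) : ℝ)) / (m : ℝ)) <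
      (0.123 : ℝ) * (polarCoef m nt m : ℝ) *
        ((m ^ 2 - 4 * m * nt : ℤ) : ℝ) ^ ((23 : ℝ) / 4) *
        besselI (23 / 2)
          (Real.pi * Real.sqrt (((4 * m * n - ℓ ^ 2 : ℤ) : ℝ) *
            ((m ^ 2 - 4 * m * nt : ℤ) : ℝ)) / (m : ℝ)) := by
  have hm0 : 0 < m := by omega
  have hmR : (0 : ℝ) < m := by exact_mod_cast hm0
  have hnt4 : 4 * nt < m := by nlinarith
  have hDelta : 3 * m ^ 2 ≤ 4 * m * n - ℓ ^ 2 := by nlinarith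
  have hDeltaR : 3 * (m : ℝ) ^ 2 ≤ ((4 * m * n - ℓ ^ 2 : ℤ) : ℝ) := by exact_mod_cast hDelta
  generalize ((4 * m * n - ℓ ^ 2 : ℤ) : ℝ) = Δ at hDeltaR ⊢
  have hΔ0 : 0 < Δ := by nlinarith
  set t : ℝ := π * √Δ / m with ht
  have ht0 : 0 < t := by positivity
  have ht3 : π * √3 ≤ t := by
    rw [ht, le_div_iff₀ hmR, mul_assoc]
    refine mul_le_mul_of_nonneg_left (Real.le_sqrt_of_sq_le ?_) Real.pi_pos.le
    rw [mul_pow, Real.sq_sqrt (by norm_num)]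
    exact hDeltaR
  have harg : ∀ w : ℝ, π * √(Δ * w) / m = t * √w := fun w => by
    rw [Real.sqrt_mul hΔ0.le, ht]; ring
  simp only [harg]
  set C : ℝ := ((4 * m * nt : ℤ) : ℝ) with hC
  have hC0 : 0 ≤ C := by rw [hC]; exact_mod_cast by positivity
  have hcast : ∀ l : ℤ, ((l ^ 2 - 4 * m * nt : ℤ) : ℝ) = (l : ℝ) ^ 2 - C := fun l => by
    rw [hC]; push_cast; ring
  simp only [hcast]
  have hCm : C < (m : ℝ) ^ 2 := by rw [hC]; exact_mod_cast hnt2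
  set T : ℝ := (t ^ ((23 : ℝ) / 2))⁻¹ with hT
  have hT0 : 0 < T := by positivity
  set K : ℝ := T * scaledBessel (t * √((m : ℝ) ^ 2 - C)) with hK
  have hK0 : 0 < K := mul_pos hT0
    (scaledBessel_pos (mul_pos ht0 (Real.sqrt_pos.2 (by linarith))))
  have hKm : ((m : ℝ) ^ 2 - C) ^ ((23 : ℝ) / 4) * besselI (23 / 2) (t * √((m : ℝ) ^ 2 - C)) = K :=
    rpow_mul_besselI_mul_sqrt ht0 (by linarith)
  set q : ℝ := Real.exp (-(π * √3)) with hq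
  have hq0 : 0 < q := Real.exp_pos _
  have hq1 : q ≤ 0.00435 := exp_neg_pi_mul_sqrt_three_le
  obtain ⟨k, rfl⟩ := Int.eq_ofNat_of_zero_le hnt
  have hd0 : (0 : ℝ) < dcoef k := by exact_mod_cast dcoef_natCast_pos k
  set W : ℝ := ((m - 2 * k : ℤ) : ℝ) * dcoef k * dcoef k * K with hW
  have hmk : (0 : ℝ) < ((m - 2 * k : ℤ) : ℝ) := by
    have : 0 < m - 2 * (k : ℤ) := by omega
    exact_mod_cast this
  have hW0 : 0 < W := by positivity
  have hterm : ∀ l ∈ (Finset.Ico (0 : ℤ) m).filter fun l => 4 * m * k - l ^ 2 < 0,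
      2 * (((l - 2 * k) * dcoef (m + k - l) * dcoef k : ℤ) : ℝ) *
          ((l : ℝ) ^ 2 - C) ^ ((23 : ℝ) / 4) * besselI (23 / 2) (t * √((l : ℝ) ^ 2 - C)) ≤
        27 / 10 * W * (10 * q) ^ (m - l).toNat := by
    intro l hl
    simp only [Finset.mem_filter, Finset.mem_Ico] at hl
    obtain ⟨⟨hl0, hlm⟩, hlC⟩ := hl
    have hCl : C < (l : ℝ) ^ 2 := by
      have : 4 * m * k < l ^ 2 := by linarith
      rw [hC]; exact_mod_cast this
    obtain ⟨j, hj⟩ : ∃ j : ℕ, m - l = j + 1 := ⟨(m - l - 1).toNat, by omega⟩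
    have hjR : (m : ℝ) - l = ((j + 1 : ℕ) : ℝ) := by exact_mod_cast hj
    have htoNat : (m - l).toNat = j + 1 := by omega
    have harg : m + k - l = ((k + (j + 1) : ℕ) : ℤ) := by push_cast; omega
    have hB : T * scaledBessel (t * √((l : ℝ) ^ 2 - C)) ≤ q ^ (j + 1) * K := by
      have := scaledBessel_decay ht3 (a := m) (b := l) (by exact_mod_cast hl0)
        (by exact_mod_cast hlm.le) hC0 hCl.le
      have e : Real.exp (-(π * √3 * ((m : ℝ) - l))) = q ^ (j + 1) := by
        rw [hjR, hq, ← Real.exp_nat_mul]; congr 1; ring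
      rw [e] at this
      rw [hK]
      nlinarith [mul_le_mul_of_nonneg_left this hT0.le]
    have hdle : 20 * (dcoef (m + k - l) : ℝ) ≤ 27 * 10 ^ (j + 1) * dcoef k := by
      rw [harg]; exact_mod_cast dcoef_add_le k j
    have hd1 : (0 : ℝ) ≤ dcoef (m + k - l) := by exact_mod_cast dcoef_nonneg _
    have hlk : ((l - 2 * k : ℤ) : ℝ) ≤ ((m - 2 * k : ℤ) : ℝ) := by
      have : l - 2 * k ≤ m - 2 * (k : ℤ) := by omega
      exact_mod_cast this
    have hB0 : 0 ≤ T * scaledBessel (t * √((l : ℝ) ^ 2 - C)) :=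
      (mul_pos hT0 (scaledBessel_pos (mul_pos ht0 (Real.sqrt_pos.2 (by linarith))))).le
    rw [mul_assoc, rpow_mul_besselI_mul_sqrt ht0 (by linarith), htoNat, Int.cast_mul,
      Int.cast_mul]
    calc 2 * (((l - 2 * k : ℤ) : ℝ) * dcoef (m + k - l) * dcoef k) *
          (T * scaledBessel (t * √((l : ℝ) ^ 2 - C)))
        ≤ 2 * (((m - 2 * k : ℤ) : ℝ) * (27 * 10 ^ (j + 1) * dcoef k / 20) * dcoef k) *
          (q ^ (j + 1) * K) := by
          gcongr
          linarith
      _ = 27 / 10 * W * (10 * q) ^ (j + 1) := by rw [hW, mul_pow]; ring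
  have hpolar : W ≤ (polarCoef m k m : ℝ) * K := by
    have h := polarCoef_lower_bound hm0 hnt4
    rw [hW]
    exact mul_le_mul_of_nonneg_right (by exact_mod_cast h) hK0.le
  calc _ ≤ ∑ l ∈ (Finset.Ico (0 : ℤ) m).filter fun l => 4 * m * k - l ^ 2 < 0,
        27 / 10 * W * (10 * q) ^ (m - l).toNat := Finset.sum_le_sum hterm
    _ ≤ ∑ l ∈ Finset.Ico (0 : ℤ) m, 27 / 10 * W * (10 * q) ^ (m - l).toNat :=
        Finset.sum_le_sum_of_subset_of_nonneg (Finset.filter_subset _ _) fun _ _ _ => by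
          positivity
    _ ≤ 27 / 10 * W * (10 * q / (1 - 10 * q)) := by
        rw [← Finset.mul_sum]
        exact mul_le_mul_of_nonneg_left
          (sum_pow_toNat_sub_le (by positivity) (by linarith) m) (by positivity)
    _ < 0.123 * W := by
        have : 10 * q / (1 - 10 * q) < 0.04555 := by
          rw [div_lt_iff₀ (by linarith)]; linarith
        nlinarith
    _ ≤ 0.123 * ((polarCoef m k m : ℝ) * K) := by linarith
    _ = _ := by rw [← hKm]; ring
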